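/- arXiv:1010.6049 — 2 statements merged into one kernel-verified Lean document; each statement's English description precedes it below -/
import Mathlib

section
/- Let n > 3 and let |Cl_n⟩⟨Cl_n| = 2^{−n} ∏_{i=1}^n (𝟙 + g_i) be the n-qubit linear cluster state, where g_1 = X_1 Z_2, g_i = Z_{i−1} X_i Z_{i+1} for 1 < i < n, and g_n = Z_{n−1} X_n. Let B = {β_1,…,β_m} ⊆ {1,…,n} be a set of qubits whose closed neighborhoods are pairwise disjoint, i.e., N̄(β_i) ∩ N̄(β_j) = ∅ for i ≠ j, where N̄(i) consists of i and its neighbors on the path graph. Define W_Cln = (1/2)𝟙 − |Cl_n⟩⟨Cl_n| − (1/2) Σ_s ∏_{i∈B} (s_i g_i + 𝟙)/2, where the sum runs over all sign vectors s ∈ {+1,−1}^m with at least two components equal to −1. Then for every nonempty strict subset M of {1,…,n} there exist positive semidefinite matrices P_M and Q_M with W_Cln = P_M + Q_M^{T_M}; that is, W_Cln is fully decomposable. -/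
open Matrix Finset ComplexOrder

/-- Operators on `(ℂ²)^{⊗n}`, indexed by bit strings `{0,1}^n`. -/
abbrev QMat (n : ℕ) := Matrix (Fin n → Fin 2) (Fin n → Fin 2) ℂ

/-- The tensor product `A 0 ⊗ ⋯ ⊗ A (n-1)` of one-qubit operators. -/
def qtensor {n : ℕ} (A : Fin n → Matrix (Fin 2) (Fin 2) ℂ) : QMat n :=
  fun v w => ∏ a, A a (v a) (w a)

def PX : Matrix (Fin 2) (Fin 2) ℂ := !![0, 1; 1, 0]

def PZ : Matrix (Fin 2) (Fin 2) ℂ := !![1, 0; 0, -1]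

/-- Partial transpose on the qubits in `M`. -/
def qpt {n : ℕ} (M : Finset (Fin n)) (X : QMat n) : QMat n :=
  fun v w => X (fun a => if a ∈ M then w a else v a) (fun a => if a ∈ M then v a else w a)

/-- The linear-cluster-state stabilizer generator: `g_1 = X_1 Z_2`,
`g_i = Z_{i-1} X_i Z_{i+1}` for `1 < i < n`, `g_n = Z_{n-1} X_n`
(the underlying graph is the path `1 – 2 – ⋯ – n`). -/
def clGen (n : ℕ) (i : Fin n) : QMat n :=
  qtensor (fun a => if a = i then PX
    else if (a : ℕ) + 1 = (i : ℕ) ∨ (i : ℕ) + 1 = (a : ℕ) then PZ else 1)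

/-- The closed neighborhood `N̄(i) = {i-1, i, i+1} ∩ {1,…,n}` of qubit `i` on the path. -/
def clNbhd (n : ℕ) (i : Fin n) : Finset (Fin n) :=
  Finset.univ.filter (fun a => a = i ∨ (a : ℕ) + 1 = (i : ℕ) ∨ (i : ℕ) + 1 = (a : ℕ))

/-- The projector `|Cl_n⟩⟨Cl_n| = 2^{-n} ∏_{i=1}^n (𝟙 + g_i)` onto the n-qubit linear
cluster state. -/
noncomputable def clProj (n : ℕ) : QMat n :=
  ((2 : ℂ) ^ n)⁻¹ • ((List.finRange n).map (fun i => 1 + clGen n i)).prod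

/-- The witness `W_Cln = 𝟙/2 − |Cl_n⟩⟨Cl_n| − (1/2) Σ_s ∏_{i∈B} (s_i g_i + 𝟙)/2`, where
the sum runs over all sign vectors `s ∈ {±1}^B` with at least two entries `−1`
(encoded as `s : Fin n → Bool` supported on `B`, `true` standing for the sign `−1`). -/
noncomputable def Wcl (n : ℕ) (B : Finset (Fin n)) : QMat n :=
  (2 : ℂ)⁻¹ • 1 - clProj n -
    (2 : ℂ)⁻¹ • ∑ s ∈ Finset.univ.filter (fun s : Fin n → Bool =>
        (∀ i ∉ B, s i = false) ∧ 2 ≤ (B.filter (fun i => s i = true)).card),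
      ((B.sort (· ≤ ·)).map
        (fun i => (2 : ℂ)⁻¹ • ((if s i then (-1 : ℂ) else 1) • clGen n i + 1))).prod

namespace ClAux

/-- sign of a pair of bits -/
def sg (a b : Fin 2) : ℂ := if a = 1 ∧ b = 1 then -1 else 1

def chi (a : Fin 2) : ℂ := if a = 1 then -1 else 1

def cc {n : ℕ} (v x : Fin n → Fin 2) : ℂ := ∏ k, sg (v k) (x k)

def ss {n : ℕ} (v : Fin n → Fin 2) : ℂ :=
  ∏ k : Fin n, ∏ l : Fin n, if (k : ℕ) + 1 = (l : ℕ) then sg (v k) (v l) else 1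

def flip {n : ℕ} (i : Fin n) (x : Fin n → Fin 2) : Fin n → Fin 2 :=
  Function.update x i (x i + 1)

lemma fin2_cases (a : Fin 2) : a = 0 ∨ a = 1 := by omega

lemma flip_flip {n : ℕ} (i : Fin n) (x : Fin n → Fin 2) : flip i (flip i x) = x := by
  funext k
  by_cases h : k = i
  · subst h
    rcases fin2_cases (x k) with h | h <;> simp [flip, h]
  · simp [flip, h]

lemma flip_ne {n : ℕ} {i k : Fin n} (h : k ≠ i) (x : Fin n → Fin 2) : flip i x k = x k := by
  simp [flip, h]

lemma flip_same {n : ℕ} (i : Fin n) (x : Fin n → Fin 2) : flip i x i = x i + 1 := by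
  simp [flip]

def flipEquiv {n : ℕ} (i : Fin n) : (Fin n → Fin 2) ≃ (Fin n → Fin 2) :=
  ⟨flip i, flip i, flip_flip i, flip_flip i⟩

lemma sum_zero {n : ℕ} (i : Fin n) (f : (Fin n → Fin 2) → ℂ)
    (h : ∀ x, f (flip i x) = - f x) : ∑ x, f x = 0 := by
  have h1 : ∑ x, f (flip i x) = ∑ x, f x := (flipEquiv i).sum_comp f
  simp only [h, Finset.sum_neg_distrib] at h1
  linear_combination (-1/2) * h1

lemma sg_comm (a b : Fin 2) : sg a b = sg b a := by simp [sg, and_comm]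

lemma cc_comm {n : ℕ} (v x : Fin n → Fin 2) : cc v x = cc x v := by
  simp [cc, sg_comm]

lemma sg_sq (a b : Fin 2) : sg a b * sg a b = 1 := by
  unfold sg; split_ifs <;> norm_num

lemma cc_sq {n : ℕ} (v x : Fin n → Fin 2) : cc v x * cc v x = 1 := by
  simp [cc, ← Finset.prod_mul_distrib, sg_sq]

lemma ss_sq {n : ℕ} (v : Fin n → Fin 2) : ss v * ss v = 1 := by
  simp only [ss, ← Finset.prod_mul_distrib]
  refine Finset.prod_eq_one fun k _ => Finset.prod_eq_one fun l _ => ?_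
  split_ifs <;> simp [sg_sq]

lemma sg_add (a b : Fin 2) : sg a (b + 1) = chi a * sg a b := by
  fin_cases a <;> fin_cases b <;> simp [sg, chi]

lemma cc_flip {n : ℕ} (i : Fin n) (v x : Fin n → Fin 2) :
    cc v (flip i x) = chi (v i) * cc v x := by
  unfold cc
  have : ∀ k, sg (v k) (flip i x k) = (if k = i then chi (v i) else 1) * sg (v k) (x k) := by
    intro k
    by_cases h : k = i
    · subst h; simp [flip_same, sg_add]
    · simp [flip_ne h, h]
  simp only [this]
  rw [Finset.prod_mul_distrib]
  simp

lemma chi_ne {a b : Fin 2} (h : a ≠ b) : chi a * chi b = -1 := by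
  fin_cases a <;> fin_cases b <;> simp_all [chi]

lemma chi_sq (a : Fin 2) : chi a * chi a = 1 := by
  fin_cases a <;> simp [chi]

lemma chi_succ (a : Fin 2) : chi (a + 1) = - chi a := by
  fin_cases a <;> simp [chi]

def FF {n : ℕ} (f : (Fin n → Fin 2) → ℂ) (v w : Fin n → Fin 2) : ℂ :=
  ∑ x, f x * (cc v x * cc w x)

lemma FF_zero_inv {n : ℕ} (f : (Fin n → Fin 2) → ℂ) (v w : Fin n → Fin 2) (k : Fin n)
    (hf : ∀ x, f (flip k x) = f x) (h : v k ≠ w k) : FF f v w = 0 := by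
  refine sum_zero k _ fun x => ?_
  rw [hf, cc_flip, cc_flip]
  linear_combination (f x * cc v x * cc w x) * chi_ne h

lemma FF_zero_neg {n : ℕ} (f : (Fin n → Fin 2) → ℂ) (v w : Fin n → Fin 2) (k : Fin n)
    (hf : ∀ x, f (flip k x) = - f x) (h : v k = w k) : FF f v w = 0 := by
  refine sum_zero k _ fun x => ?_
  rw [hf, cc_flip, cc_flip, h]
  linear_combination (- f x * cc v x * cc w x) * chi_sq (w k)

def UU (n : ℕ) : QMat n := fun v x => ss v * cc v x

lemma UU_mul (n : ℕ) : UU n * (UU n)ᴴ = ((2 : ℂ) ^ n) • 1 := by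
  ext v w
  have hs : ∀ z : Fin n → Fin 2, ∀ x, star (UU n z x) = UU n z x := by
    intro z x
    have h1 : ∀ a b, star (sg a b) = sg a b := by
      intro a b; unfold sg; split_ifs <;> simp
    have h2 : ∀ a b, (starRingEnd ℂ) (sg a b) = sg a b := h1
    simp only [UU, ss, cc]
    change (starRingEnd ℂ) _ = _
    simp only [map_mul, map_prod, h2]
    congr 1
    refine Finset.prod_congr rfl fun k _ => Finset.prod_congr rfl fun l _ => ?_
    split_ifs <;> simp [h2]
  have : (UU n * (UU n)ᴴ) v w = ss v * ss w * FF (fun _ => 1) v w := by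
    simp only [Matrix.mul_apply, Matrix.conjTranspose_apply, hs, FF, Finset.mul_sum]
    refine Finset.sum_congr rfl fun x _ => ?_
    simp only [UU]; ring
  rw [this]
  by_cases h : v = w
  · subst h
    simp [FF, cc_sq, ss_sq]
  · obtain ⟨k, hk⟩ := Function.ne_iff.mp h
    rw [FF_zero_inv _ v w k (fun _ => rfl) hk]
    simp [h]

lemma UU_mul' (n : ℕ) : (UU n)ᴴ * UU n = ((2 : ℂ) ^ n) • 1 := by
  have h := UU_mul n
  have h2 : ((2 : ℂ) ^ n) ≠ 0 := pow_ne_zero _ two_ne_zero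
  have h3 : (((2 : ℂ) ^ n)⁻¹ • UU n) * (UU n)ᴴ = 1 := by
    rw [Matrix.smul_mul, h, smul_smul, inv_mul_cancel₀ h2, one_smul]
  have h4 := mul_eq_one_comm.mp h3
  rw [Matrix.mul_smul] at h4
  rw [← h4, smul_smul, mul_inv_cancel₀ h2, one_smul]

noncomputable def PhiL (n : ℕ) : ((Fin n → Fin 2) → ℂ) →ₗ[ℂ] QMat n where
  toFun f := ((2 : ℂ) ^ n)⁻¹ • (UU n * Matrix.diagonal f * (UU n)ᴴ)
  map_add' f g := by
    have : Matrix.diagonal (f + g) = Matrix.diagonal f + Matrix.diagonal g := by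
      simp [Matrix.diagonal_add]
    rw [this, Matrix.mul_add, Matrix.add_mul, smul_add]
  map_smul' c f := by
    have : Matrix.diagonal (c • f) = c • Matrix.diagonal f := by
      simp [Matrix.diagonal_smul]
    rw [this, Matrix.mul_smul, Matrix.smul_mul, smul_comm]; rfl

noncomputable def Phi (n : ℕ) : ((Fin n → Fin 2) → ℂ) →ₐ[ℂ] QMat n :=
  AlgHom.ofLinearMap (PhiL n)
    (by
      have h2 : ((2 : ℂ) ^ n) ≠ 0 := pow_ne_zero _ two_ne_zero
      have : Matrix.diagonal (1 : (Fin n → Fin 2) → ℂ) = 1 := Matrix.diagonal_one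
      simp only [PhiL, LinearMap.coe_mk, AddHom.coe_mk, this, Matrix.mul_one, UU_mul, smul_smul,
        inv_mul_cancel₀ h2, one_smul])
    (by
      intro f g
      have h2 : ((2 : ℂ) ^ n) ≠ 0 := pow_ne_zero _ two_ne_zero
      have h1 : Matrix.diagonal (f * g) = Matrix.diagonal f * Matrix.diagonal g := by
        rw [Matrix.diagonal_mul_diagonal]; rfl
      have h3 : (UU n * Matrix.diagonal f * (UU n)ᴴ) * (UU n * Matrix.diagonal g * (UU n)ᴴ)
          = ((2 : ℂ) ^ n) • (UU n * Matrix.diagonal (f * g) * (UU n)ᴴ) := by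
        calc _ = UU n * Matrix.diagonal f * ((UU n)ᴴ * UU n) * Matrix.diagonal g * (UU n)ᴴ := by
              simp only [Matrix.mul_assoc]
          _ = _ := by
              rw [UU_mul', h1]
              simp only [Matrix.mul_smul, Matrix.smul_mul, Matrix.mul_one, Matrix.mul_assoc]
      simp only [PhiL, LinearMap.coe_mk, AddHom.coe_mk, Matrix.smul_mul, Matrix.mul_smul, h3,
        smul_smul]
      rw [inv_mul_cancel₀ h2, mul_one])

lemma star_UU {n : ℕ} (z x : Fin n → Fin 2) : star (UU n z x) = UU n z x := by
  have h1 : ∀ a b, star (sg a b) = sg a b := by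
    intro a b; unfold sg; split_ifs <;> simp
  have h2 : ∀ a b, (starRingEnd ℂ) (sg a b) = sg a b := h1
  simp only [UU, ss, cc]
  change (starRingEnd ℂ) _ = _
  simp only [map_mul, map_prod, h2]
  congr 1
  refine Finset.prod_congr rfl fun k _ => Finset.prod_congr rfl fun l _ => ?_
  split_ifs <;> simp [h2]

lemma Phi_apply {n : ℕ} (f : (Fin n → Fin 2) → ℂ) (v w : Fin n → Fin 2) :
    Phi n f v w = ((2 : ℂ) ^ n)⁻¹ * (ss v * ss w * FF f v w) := by
  change (((2 : ℂ) ^ n)⁻¹ • (UU n * Matrix.diagonal f * (UU n)ᴴ)) v w = _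
  rw [Matrix.smul_apply, smul_eq_mul]
  congr 1
  rw [Matrix.mul_apply]
  simp only [Matrix.mul_diagonal, Matrix.conjTranspose_apply, star_UU, FF, Finset.mul_sum]
  refine Finset.sum_congr rfl fun x _ => ?_
  simp only [UU]; ring

lemma Phi_psd {n : ℕ} (f : (Fin n → Fin 2) → ℂ) (hf : ∀ x, 0 ≤ f x) : (Phi n f).PosSemidef := by
  change (((2 : ℂ) ^ n)⁻¹ • (UU n * Matrix.diagonal f * (UU n)ᴴ)).PosSemidef
  refine Matrix.PosSemidef.smul ?_ ?_
  · exact (Matrix.PosSemidef.diagonal hf).mul_mul_conjTranspose_same _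
  · have : (0 : ℂ) ≤ 2 := by norm_num
    positivity

lemma ss_flip {n : ℕ} (i : Fin n) (v : Fin n → Fin 2) :
    ss v * ss (flip i v) =
      ∏ a : Fin n, if (a : ℕ) + 1 = (i : ℕ) ∨ (i : ℕ) + 1 = (a : ℕ) then chi (v a) else 1 := by
  have key : ∀ k l : Fin n,
      (if (k : ℕ) + 1 = (l : ℕ) then sg (v k) (v l) else 1) *
      (if (k : ℕ) + 1 = (l : ℕ) then sg (flip i v k) (flip i v l) else 1) =
      (if k = i then (if (i : ℕ) + 1 = (l : ℕ) then chi (v l) else 1) else 1) *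
      (if l = i then (if (k : ℕ) + 1 = (i : ℕ) then chi (v k) else 1) else 1) := by
    intro k l
    by_cases hkl : (k : ℕ) + 1 = (l : ℕ)
    · by_cases hk : k = i
      · subst hk
        have hl : l ≠ k := by rintro rfl; omega
        simp only [hkl, if_true, hl, if_false, flip_same, flip_ne hl, mul_one]
        rw [sg_comm (v k + 1), sg_add, sg_comm (v l)]
        linear_combination chi (v l) * sg_sq (v k) (v l)
      · by_cases hl : l = i
        · subst hl
          simp only [hkl, if_true, hk, if_false, flip_same, flip_ne hk, one_mul]
          rw [sg_add]
          linear_combination chi (v k) * sg_sq (v k) (v l)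
        · simp [hkl, hk, hl, flip_ne hk, flip_ne hl, sg_sq]
    · by_cases hk : k = i
      · subst hk
        by_cases hl : l = k
        · subst hl; simp
        · simp [hkl, hl]
      · by_cases hl : l = i
        · subst hl; simp [hkl, hk]
        · simp [hkl, hk, hl]
  simp only [ss, ← Finset.prod_mul_distrib, key]
  simp only [Finset.prod_mul_distrib]
  rw [Finset.prod_comm]
  simp only [Finset.prod_ite_eq', Finset.mem_univ, if_true]
  rw [← Finset.prod_mul_distrib]
  refine Finset.prod_congr rfl fun a _ => ?_
  by_cases h1 : (a : ℕ) + 1 = (i : ℕ)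
  · have : ¬ ((i : ℕ) + 1 = (a : ℕ)) := by omega
    simp [h1, this]
  · simp [h1]

lemma clGen_eq {n : ℕ} (i : Fin n) : clGen n i = Phi n (fun x => chi (x i)) := by
  ext v w
  have h2 : ((2 : ℂ) ^ n) ≠ 0 := pow_ne_zero _ two_ne_zero
  rw [Phi_apply]
  by_cases hw : w = flip i v
  · subst hw
    have h1 : FF (fun x => chi (x i)) v (flip i v) = 2 ^ n := by
      have : ∀ x, chi (x i) * (cc v x * cc (flip i v) x) = 1 := by
        intro x
        rw [cc_comm (flip i v), cc_flip, cc_comm x]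
        linear_combination (chi (x i) * chi (x i)) * cc_sq v x + chi_sq (x i)
      simp [FF, this]
    rw [h1, ss_flip]
    rw [mul_comm, mul_assoc, mul_inv_cancel₀ h2, mul_one]
    unfold clGen qtensor
    refine Finset.prod_congr rfl fun a _ => ?_
    by_cases ha : a = i
    · subst ha
      simp only [if_true, flip_same]
      rcases fin2_cases (v a) with h | h <;> simp [h, PX]
    · simp only [ha, if_false, flip_ne ha]
      split_ifs
      · rcases fin2_cases (v a) with h | h <;> simp [h, PZ, chi]
      · simp
  · obtain ⟨k, hk⟩ := Function.ne_iff.mp hw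
    have hz : clGen n i v w = 0 := by
      unfold clGen qtensor
      refine Finset.prod_eq_zero (Finset.mem_univ k) ?_
      by_cases hki : k = i
      · subst hki
        rw [flip_same] at hk
        rcases fin2_cases (v k) with h | h <;> rcases fin2_cases (w k) with h' | h' <;>
          simp_all [PX]
      · rw [flip_ne hki] at hk
        simp only [hki, if_false]
        split_ifs
        · rcases fin2_cases (v k) with h | h <;> rcases fin2_cases (w k) with h' | h' <;>
          simp_all [PZ]
        · exact Matrix.one_apply_ne (Ne.symm hk)
    rw [hz]
    have : FF (fun x => chi (x i)) v w = 0 := by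
      by_cases hki : k = i
      · subst hki
        rw [flip_same] at hk
        refine FF_zero_neg _ v w k (fun x => by rw [flip_same, chi_succ]) ?_
        rcases fin2_cases (v k) with h | h <;> rcases fin2_cases (w k) with h' | h' <;>
          simp_all
      · rw [flip_ne hki] at hk
        exact FF_zero_inv _ v w k (fun x => by rw [flip_ne (Ne.symm hki)]) (Ne.symm hk)
    rw [this]; ring

lemma sort_prod {n : ℕ} (B : Finset (Fin n)) (f : Fin n → ℂ) :
    ((B.sort (· ≤ ·)).map f).prod = ∏ i ∈ B, f i := by
  rw [← Multiset.prod_coe, ← Multiset.map_coe, Finset.sort_eq]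
  rfl

/-- eigenvalues of the witness -/
noncomputable def fW {n : ℕ} (B : Finset (Fin n)) (x : Fin n → Fin 2) : ℂ :=
  2⁻¹ - (if x = 0 then 1 else 0) - 2⁻¹ * (if 2 ≤ (B.filter (fun i => x i = 1)).card then 1 else 0)

lemma Wcl_eq {n : ℕ} (B : Finset (Fin n)) : Wcl n B = Phi n (fW B) := by
  have h1 : clProj n = Phi n (fun x => if x = 0 then 1 else 0) := by
    unfold clProj
    have : (fun i => 1 + clGen n i) = (fun i => Phi n (1 + fun x => chi (x i))) := by
      funext i; rw [map_add, map_one, clGen_eq]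
    rw [this, show (fun i => Phi n (1 + fun x => chi (x i))) =
      (Phi n) ∘ (fun i => (1 + fun x : Fin n → Fin 2 => chi (x i))) from rfl,
      ← List.map_map, ← map_list_prod, ← map_smul]
    congr 1
    funext x
    rw [Pi.smul_apply, ← Fin.prod_univ_def, Finset.prod_apply]
    by_cases hx : x = 0
    · subst hx
      simp [chi]
      norm_num
    · obtain ⟨k, hk⟩ := Function.ne_iff.mp hx
      have hk1 : x k = 1 := by
        rcases fin2_cases (x k) with h | h
        · exact absurd h hk
        · exact h
      rw [Finset.prod_eq_zero (Finset.mem_univ k) (by simp [hk1, chi])]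
      simp [hx]
  unfold Wcl
  rw [h1]
  have h3 : ∀ s : Fin n → Bool, ((B.sort (· ≤ ·)).map
        (fun i => (2 : ℂ)⁻¹ • ((if s i then (-1 : ℂ) else 1) • clGen n i + 1))).prod =
      Phi n (fun x => ∏ i ∈ B, (2 : ℂ)⁻¹ * ((if s i then (-1 : ℂ) else 1) * chi (x i) + 1)) := by
    intro s
    have : (fun i => (2 : ℂ)⁻¹ • ((if s i then (-1 : ℂ) else 1) • clGen n i + 1)) =
      (Phi n) ∘ (fun i => (2 : ℂ)⁻¹ • ((if s i then (-1 : ℂ) else 1) •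
        (fun x : Fin n → Fin 2 => chi (x i)) + 1)) := by
      funext i
      simp only [Function.comp, map_smul, map_add, map_one, clGen_eq]
    rw [this, ← List.map_map, ← map_list_prod]
    congr 1
    funext x
    rw [← sort_prod]
    refine (map_list_prod (Pi.evalRingHom (fun _ : Fin n → Fin 2 => ℂ) x) _).trans ?_
    rw [List.map_map]
    rfl
  simp only [h3]
  rw [← map_sum, ← map_one (Phi n), ← map_smul, ← map_smul, ← map_sub, ← map_sub]
  congr 1
  funext x
  simp only [fW, Pi.sub_apply, Pi.smul_apply, Pi.one_apply, smul_eq_mul, mul_one, Finset.sum_apply]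
  congr 2
  set t : Fin n → Bool := fun i => decide (i ∈ B ∧ x i = 1) with ht
  have hterm : ∀ s : Fin n → Bool, (∀ i ∉ B, s i = false) → s ≠ t →
      ∏ i ∈ B, (2 : ℂ)⁻¹ * ((if s i then (-1 : ℂ) else 1) * chi (x i) + 1) = 0 := by
    intro s hs hst
    obtain ⟨k, hk⟩ := Function.ne_iff.mp hst
    have hkB : k ∈ B := by
      by_contra hkB
      apply hk
      simp [hs k hkB, ht, hkB]
    refine Finset.prod_eq_zero hkB ?_
    rcases fin2_cases (x k) with h | h <;> cases hsk : s k <;> simp_all [chi]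
  have hcard : (B.filter (fun i => t i = true)) = B.filter (fun i => x i = 1) := by
    ext i; simp [ht]
  split_ifs with hc
  · rw [Finset.sum_eq_single t]
    · refine Finset.prod_eq_one fun i hi => ?_
      rcases fin2_cases (x i) with h | h <;> simp [ht, h, hi, chi] <;> norm_num
    · intro s hs hst
      exact hterm s (Finset.mem_filter.mp hs).2.1 hst
    · intro h
      exfalso; apply h
      refine Finset.mem_filter.mpr ⟨Finset.mem_univ _, ?_, ?_⟩
      · intro i hi; simp [ht, hi]
      · rw [hcard]; exact hc
  · refine Finset.sum_eq_zero fun s hs => ?_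
    have hs' := (Finset.mem_filter.mp hs).2
    refine hterm s hs'.1 ?_
    rintro rfl
    rw [hcard] at hs'
    exact hc hs'.2

/-- crossing edge -/
def Cross {n : ℕ} (M : Finset (Fin n)) (k l : Fin n) : Prop :=
  (k : ℕ) + 1 = (l : ℕ) ∧ ((k ∈ M ∧ l ∉ M) ∨ (k ∉ M ∧ l ∈ M))

lemma exists_cross {n : ℕ} (M : Finset (Fin n)) (h1 : M.Nonempty) (h2 : M ≠ Finset.univ) :
    ∃ k l, Cross M k l := by
  by_contra hcon
  push Not at hcon
  obtain ⟨m, hm⟩ := h1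
  apply h2
  have h0 : 0 < n := by have := m.2; omega
  have hstep : ∀ k : ℕ, ∀ hk : k < n, ((⟨k, hk⟩ : Fin n) ∈ M ↔ (⟨0, h0⟩ : Fin n) ∈ M) := by
    intro k
    induction k with
    | zero => intro hk; rfl
    | succ k ih =>
      intro hk
      rw [← ih (by omega)]
      have := hcon ⟨k, by omega⟩ ⟨k+1, hk⟩
      unfold Cross at this
      simp only [true_and] at this
      tauto
  ext a
  simp only [Finset.mem_univ, iff_true]
  exact (hstep a a.2).mpr ((hstep m m.2).mp hm)

lemma exists_good {n : ℕ} (B M : Finset (Fin n)) (h1 : M.Nonempty) (h2 : M ≠ Finset.univ)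
    (hB : ∀ i ∈ B, ∀ j ∈ B, i ≠ j → Disjoint (clNbhd n i) (clNbhd n j)) :
    ∃ i j, Cross M i j ∧ ∀ k l, Cross M k l → (k ∈ B ∨ k = i ∨ k = j) → (l ∈ B ∨ l = i ∨ l = j) →
      k = i ∧ l = j := by
  have hd : ∀ i ∈ B, ∀ j ∈ B, ∀ a : Fin n,
      (a = i ∨ (a : ℕ) + 1 = (i : ℕ) ∨ (i : ℕ) + 1 = (a : ℕ)) →
      (a = j ∨ (a : ℕ) + 1 = (j : ℕ) ∨ (j : ℕ) + 1 = (a : ℕ)) → i = j := by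
    intro i hi j hj a ha hb
    by_contra hne
    refine Finset.disjoint_left.mp (hB i hi j hj hne) (?_ : a ∈ _) ?_ <;> simp [clNbhd, ha, hb]
  by_cases hx : ∃ i j, Cross M i j ∧ (i ∈ B ∨ j ∈ B)
  · obtain ⟨i, j, hc, hij⟩ := hx
    refine ⟨i, j, hc, ?_⟩
    intro k l hkl hk hl
    have e1 := hc.1
    have e2 := hkl.1
    suffices h : k = i by
      subst h; exact ⟨rfl, Fin.ext (by omega)⟩
    by_contra hne
    have hne' : (k : ℕ) ≠ i := fun h => hne (Fin.ext h)
    -- k in B or k = j ; l in B or l = i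
    have hl' : l ∈ B ∨ l = i := by
      rcases hl with h | h | h
      · exact Or.inl h
      · exact Or.inr h
      · subst h; omega
    have hk' : k ∈ B ∨ k = j := by tauto
    clear hk hl
    rcases hk' with hk | rfl
    · rcases hl' with hl | rfl
      · have := hd k hk l hl k (Or.inl rfl) (by omega)
        subst this; omega
      · rcases hij with h | h
        · have := hd k hk l h k (Or.inl rfl) (by omega)
          subst this; omega
        · have := hd k hk j h l (by omega) (by omega)
          subst this; omega
    · rcases hl' with hl | rfl
      · rcases hij with h | h
        · have := hd i h l hl k (by omega) (by omega)
          subst this; omega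
        · have := hd k h l hl k (by omega) (by omega)
          subst this; omega
      · omega
  · push Not at hx
    obtain ⟨i, j, hc⟩ := exists_cross M h1 h2
    refine ⟨i, j, hc, ?_⟩
    intro k l hkl hk hl
    have := hx k l hkl
    have e1 := hc.1
    have e2 := hkl.1
    have hk : k = i ∨ k = j := by tauto
    have hl : l = i ∨ l = j := by tauto
    rcases hk with rfl | rfl <;> rcases hl with rfl | rfl
    · omega
    · exact ⟨rfl, rfl⟩
    · omega
    · omega

def sw {n : ℕ} (M : Finset (Fin n)) (v w : Fin n → Fin 2) : Fin n → Fin 2 :=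
  fun a => if a ∈ M then w a else v a

lemma sw_cc {n : ℕ} (M : Finset (Fin n)) (v w x : Fin n → Fin 2) :
    cc (sw M v w) x * cc (sw M w v) x = cc v x * cc w x := by
  simp only [cc, ← Finset.prod_mul_distrib, sw]
  refine Finset.prod_congr rfl fun k _ => ?_
  split_ifs <;> ring

lemma sg4 (a b c d : Fin 2) : sg a b * sg c d =
    (sg c b * sg a d) * (if a ≠ c ∧ b ≠ d then -1 else 1) := by
  fin_cases a <;> fin_cases b <;> fin_cases c <;> fin_cases d <;> simp [sg]

open Classical in
lemma sw_ss {n : ℕ} (M : Finset (Fin n)) (v w : Fin n → Fin 2) :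
    ss (sw M v w) * ss (sw M w v) = ss v * ss w *
      ∏ k : Fin n, ∏ l : Fin n, if Cross M k l ∧ v k ≠ w k ∧ v l ≠ w l then -1 else 1 := by
  simp only [ss, ← Finset.prod_mul_distrib]
  refine Finset.prod_congr rfl fun k _ => Finset.prod_congr rfl fun l _ => ?_
  by_cases hkl : (k : ℕ) + 1 = (l : ℕ)
  · by_cases hk : k ∈ M <;> by_cases hl : l ∈ M <;> simp only [Cross, hkl, hk, hl, sw, if_true, if_false,
      true_and, false_and, or_true, or_false, not_true, not_false_eq_true, and_true, and_false, mul_one]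
    · ring
    · have := sg4 (w k) (v l) (v k) (w l)
      rw [this]
      simp only [ne_eq, eq_comm]
    · have := sg4 (v k) (w l) (w k) (v l)
      rw [this]
      simp only [ne_eq, eq_comm]
      ring
  · simp [Cross, hkl]

/-- product constraint -/
noncomputable def RR {n : ℕ} (B : Finset (Fin n)) (i j : Fin n) (x : Fin n → Fin 2) : ℂ :=
  if ∀ b ∈ B, b ≠ i → b ≠ j → x b = 0 then 1 else 0

noncomputable def qq {n : ℕ} (B : Finset (Fin n)) (i j : Fin n) (x : Fin n → Fin 2) : ℂ :=
  4⁻¹ * RR B i j x * (1 - chi (x i) - chi (x j) + chi (x i) * chi (x j))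

noncomputable def qq' {n : ℕ} (B : Finset (Fin n)) (i j : Fin n) (x : Fin n → Fin 2) : ℂ :=
  4⁻¹ * RR B i j x * (1 - chi (x i) - chi (x j) - chi (x i) * chi (x j))

lemma RR_flip {n : ℕ} (B : Finset (Fin n)) (i j k : Fin n) (hk : k ∉ B ∨ k = i ∨ k = j)
    (x : Fin n → Fin 2) : RR B i j (flip k x) = RR B i j x := by
  unfold RR
  congr 1
  refine propext (forall_congr' fun b => ?_)
  refine forall_congr' fun hb => forall_congr' fun hbi => forall_congr' fun hbj => ?_
  have : b ≠ k := by rintro rfl; tauto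
  rw [flip_ne this]

lemma FF_add {n : ℕ} (f g : (Fin n → Fin 2) → ℂ) (v w : Fin n → Fin 2) :
    FF (fun x => f x + g x) v w = FF f v w + FF g v w := by
  simp [FF, add_mul, Finset.sum_add_distrib]

lemma qpt_qq {n : ℕ} (B M : Finset (Fin n)) (i j : Fin n) (hc : Cross M i j)
    (hg : ∀ k l, Cross M k l → (k ∈ B ∨ k = i ∨ k = j) → (l ∈ B ∨ l = i ∨ l = j) →
      k = i ∧ l = j) :
    qpt M (Phi n (qq B i j)) = Phi n (qq' B i j) := by
  classical
  have hij : i ≠ j := by rintro rfl; have := hc.1; omega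
  ext v w
  change Phi n (qq B i j) (sw M v w) (sw M w v) = _
  rw [Phi_apply, Phi_apply]
  congr 1
  have hF : FF (qq B i j) (sw M v w) (sw M w v) = FF (qq B i j) v w := by
    simp only [FF, sw_cc]
  rw [hF, sw_ss]
  by_cases hD : ∃ k, ¬ (k ∈ B ∨ k = i ∨ k = j) ∧ v k ≠ w k
  · obtain ⟨k, hk, hvw⟩ := hD
    push Not at hk
    obtain ⟨hkB, hki, hkj⟩ := hk
    rw [FF_zero_inv (qq B i j) v w k _ hvw, FF_zero_inv (qq' B i j) v w k _ hvw]
    · ring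
    all_goals
      intro x
      simp only [qq, qq', RR_flip B i j k (Or.inl hkB), flip_ne (Ne.symm hki), flip_ne (Ne.symm hkj)]
  · push Not at hD
    have hprod : (∏ k : Fin n, ∏ l : Fin n,
        if Cross M k l ∧ v k ≠ w k ∧ v l ≠ w l then (-1 : ℂ) else 1) =
        if v i ≠ w i ∧ v j ≠ w j then -1 else 1 := by
      have hmem : ∀ k, v k ≠ w k → (k ∈ B ∨ k = i ∨ k = j) := by
        intro k hk
        by_contra h
        push Not at h
        exact hk (hD k h)
      rw [Finset.prod_eq_single i, Finset.prod_eq_single j]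
      · simp [hc]
      · intro l _ hl
        rw [if_neg]
        rintro ⟨h1, h2, h3⟩
        exact hl (hg i l h1 (hmem _ h2) (hmem _ h3)).2
      · simp
      · intro k _ hk
        refine Finset.prod_eq_one fun l _ => ?_
        rw [if_neg]
        rintro ⟨h1, h2, h3⟩
        exact hk (hg k l h1 (hmem _ h2) (hmem _ h3)).1
      · simp
    rw [hprod]
    have hRi := RR_flip B i j i (Or.inr (Or.inl rfl))
    have hRj := RR_flip B i j j (Or.inr (Or.inr rfl))
    split_ifs with h
    · have e : FF (qq' B i j) v w + FF (qq B i j) v w = 0 := by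
        rw [← FF_add]
        have : (fun x => qq' B i j x + qq B i j x) = (fun x =>
          (2⁻¹ * RR B i j x * (1 - chi (x i))) + (- 2⁻¹ * RR B i j x * chi (x j))) := by
          funext x; simp only [qq, qq']; ring
        rw [this, FF_add, FF_zero_inv _ v w j _ h.2, FF_zero_inv _ v w i _ h.1]
        · ring
        · intro x; simp only [hRi, flip_ne (Ne.symm hij)]
        · intro x; simp only [hRj, flip_ne hij]
      linear_combination (-ss v * ss w) * e
    · have e : FF (qq B i j) v w = FF (qq' B i j) v w := by
        have : qq B i j = (fun x => qq' B i j x + 2⁻¹ * RR B i j x * (chi (x i) * chi (x j))) := by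
          funext x; simp only [qq, qq']; ring
        rw [this, FF_add]
        have : FF (fun x => 2⁻¹ * RR B i j x * (chi (x i) * chi (x j))) v w = 0 := by
          by_cases hi : v i = w i
          · refine FF_zero_neg _ v w i (fun x => ?_) hi
            simp only [hRi, flip_ne (Ne.symm hij), flip_same, chi_succ]; ring
          · have hj : v j = w j := by tauto
            refine FF_zero_neg _ v w j (fun x => ?_) hj
            simp only [hRj, flip_ne hij, flip_same, chi_succ]; ring
        rw [this, add_zero]
      rw [e]; ring

lemma qq_nonneg {n : ℕ} (B : Finset (Fin n)) (i j : Fin n) (x : Fin n → Fin 2) :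
    0 ≤ qq B i j x := by
  unfold qq RR chi
  split_ifs <;> norm_num

lemma p_nonneg {n : ℕ} (B : Finset (Fin n)) (i j : Fin n)
    (hij : ¬ (i ∈ B ∧ j ∈ B)) (x : Fin n → Fin 2) :
    0 ≤ fW B x - qq' B i j x := by
  by_cases hR : ∀ b ∈ B, b ≠ i → b ≠ j → x b = 0
  · have hcard : ¬ 2 ≤ (B.filter (fun i => x i = 1)).card := by
      have : (B.filter (fun i => x i = 1)).card ≤ 1 := by
        rw [Finset.card_le_one]
        have : ∀ a, a ∈ B.filter (fun i => x i = 1) → a ∈ B ∧ (a = i ∨ a = j) := by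
          intro a ha
          obtain ⟨ha, hxa⟩ := Finset.mem_filter.mp ha
          refine ⟨ha, ?_⟩
          by_contra hcon
          push Not at hcon
          have := hR a ha hcon.1 hcon.2
          rw [this] at hxa
          exact absurd hxa (by decide)
        intro a ha b hb
        obtain ⟨ha, h1⟩ := this a ha
        obtain ⟨hb, h2⟩ := this b hb
        rcases h1 with rfl | rfl <;> rcases h2 with rfl | rfl <;> first | rfl | (exfalso; tauto)
      omega
    simp only [fW, hcard, if_false, qq', RR, if_pos hR]
    by_cases hx : x = 0
    · subst hx
      simp [chi]
      norm_num
    · simp only [hx, if_false, chi]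
      split_ifs <;> norm_num
  · have hx : x ≠ 0 := by
      rintro rfl; exact hR (fun _ _ _ _ => rfl)
    simp only [fW, qq', RR, if_neg hR, if_neg hx]
    split_ifs
    · norm_num
    · rw [Complex.le_def]; norm_num

end ClAux

/-- for `n > 3` and a set `B` of qubits with pairwise disjoint closed
neighborhoods, the cluster-state witness `W_Cln` is fully decomposable: for every
nonempty strict subset `M` there are PSD matrices `P_M, Q_M` with
`W_Cln = P_M + Q_M^{T_M}`. -/
theorem cluster_witness_fully_decomposable
    (n : ℕ) (hn : 3 < n) (B : Finset (Fin n))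
    (hB : ∀ i ∈ B, ∀ j ∈ B, i ≠ j → Disjoint (clNbhd n i) (clNbhd n j)) :
    ∀ M : Finset (Fin n), M.Nonempty → M ≠ Finset.univ →
      ∃ P Q : QMat n, P.PosSemidef ∧ Q.PosSemidef ∧ Wcl n B = P + qpt M Q := by
  intro M h1 h2
  obtain ⟨i, j, hc, hg⟩ := ClAux.exists_good B M h1 h2 hB
  refine ⟨ClAux.Phi n (ClAux.fW B - ClAux.qq' B i j), ClAux.Phi n (ClAux.qq B i j),
    ClAux.Phi_psd _ ?_, ClAux.Phi_psd _ (ClAux.qq_nonneg B i j), ?_⟩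
  · refine ClAux.p_nonneg B i j ?_
    rintro ⟨hi, hj⟩
    have e := hc.1
    have hne : i ≠ j := by rintro rfl; omega
    refine Finset.disjoint_left.mp (hB i hi j hj hne) (?_ : i ∈ _) ?_ <;> simp [clNbhd, e]
  · rw [ClAux.qpt_qq B M i j hc hg, ← map_add, sub_add_cancel, ClAux.Wcl_eq]
end

section
/- Let |W_3⟩ = (|001⟩ + |010⟩ + |100⟩)/√3 be the three-qubit W state and for 0 ≤ p ≤ 1 let ρ(p) = (1−p)|W_3⟩⟨W_3| + p·𝟙/8 on (ℂ²)^{⊗3}. Define p̄ = (367 − 71√3 − √(2894√3 − 2988))/382 (≈ 0.52102). Then for every p with p̄ ≤ p ≤ 1, the state ρ(p) is biseparable. -/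
open Matrix Finset ComplexOrder

/-- Operators on `(ℂ²)^{⊗3}`, indexed by bit strings `{0,1}^3`. -/
abbrev QMat3 := Matrix (Fin 3 → Fin 2) (Fin 3 → Fin 2) ℂ

/-- The three-qubit W state `|W_3⟩ = (|001⟩ + |010⟩ + |100⟩)/√3`. -/
noncomputable def wVec : (Fin 3 → Fin 2) → ℂ :=
  fun v => if (∑ i, (v i : ℕ)) = 1 then ((Real.sqrt 3)⁻¹ : ℝ) else 0

/-- The W state mixed with white noise, `ρ(p) = (1−p)|W_3⟩⟨W_3| + p 𝟙/8`. -/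
noncomputable def rhoW (p : ℝ) : QMat3 :=
  ((1 - p : ℝ) : ℂ) • Matrix.vecMulVec wVec (star wVec) + ((p / 8 : ℝ) : ℂ) • 1

/-- Separability of a three-qubit operator with respect to the bipartition
`{i} | {i}ᶜ`: a finite convex combination `Σ_k q_k |φ_k⟩⟨φ_k| ⊗ |ψ_k⟩⟨ψ_k|` of tensor
products of a pure state `φ_k` on qubit `i` and a pure state `ψ_k` on the remaining
two qubits (the tensor product written entrywise). -/
def SepPure (i : Fin 3) (ρ : QMat3) : Prop :=
  ∃ (m : ℕ) (q : Fin m → ℝ)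
    (φ : Fin m → Fin 2 → ℂ) (ψ : Fin m → ({a : Fin 3 // a ≠ i} → Fin 2) → ℂ),
    (∀ k, 0 ≤ q k) ∧ (∑ k, q k = 1) ∧
    (∀ k, ∑ x, Complex.normSq (φ k x) = 1) ∧
    (∀ k, ∑ x, Complex.normSq (ψ k x) = 1) ∧
    (∀ v w, ρ v w = ∑ k, (q k : ℂ)
        * (φ k (v i) * starRingEnd ℂ (φ k (w i)))
        * (ψ k (fun a => v a.1) * starRingEnd ℂ (ψ k (fun a => w a.1))))

/-- A three-qubit state is biseparable if it is a convex combination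
`p₁ ρ_{A|BC} + p₂ ρ_{B|AC} + p₃ ρ_{C|AB}` of states separable with respect to the
three bipartitions. -/
def IsBiseparable3 (ρ : QMat3) : Prop :=
  ∃ (p₁ p₂ p₃ : ℝ) (ρA ρB ρC : QMat3),
    0 ≤ p₁ ∧ 0 ≤ p₂ ∧ 0 ≤ p₃ ∧ p₁ + p₂ + p₃ = 1 ∧
    SepPure 0 ρA ∧ SepPure 1 ρB ∧ SepPure 2 ρC ∧
    ρ = (p₁ : ℂ) • ρA + (p₂ : ℂ) • ρB + (p₃ : ℂ) • ρC

/-- The critical white-noise level `p̄ ≈ 0.52102`. -/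
noncomputable def pBar : ℝ :=
  (367 - 71 * Real.sqrt 3 - Real.sqrt (2894 * Real.sqrt 3 - 2988)) / 382


/-- Amplitudes of the two-qubit factor as a function of the Hamming weight. -/
noncomputable def gAmp (B G : ℝ) (n : ℕ) : ℝ := if n = 0 then 1 else if n = 1 then B else G

/-- Real amplitude of the product vector for the bipartition `i`. -/
noncomputable def fAmp (z B G : ℝ) (i : Fin 3) (v : Fin 3 → Fin 2) : ℝ :=
  z ^ (v i : ℕ) * gAmp B G (∑ a : {a : Fin 3 // a ≠ i}, (v a.1 : ℕ))

lemma sepPure_of_fintype {κ : Type} [Fintype κ] (i : Fin 3) (ρ : QMat3) (q : κ → ℝ)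
    (φ : κ → Fin 2 → ℂ) (ψ : κ → ({a : Fin 3 // a ≠ i} → Fin 2) → ℂ)
    (h0 : ∀ k, 0 ≤ q k) (h1 : ∑ k, q k = 1)
    (h2 : ∀ k, ∑ x, Complex.normSq (φ k x) = 1)
    (h3 : ∀ k, ∑ x, Complex.normSq (ψ k x) = 1)
    (h4 : ∀ v w, ρ v w = ∑ k, (q k : ℂ)
        * (φ k (v i) * starRingEnd ℂ (φ k (w i)))
        * (ψ k (fun a => v a.1) * starRingEnd ℂ (ψ k (fun a => w a.1)))) :
    SepPure i ρ := by
  let e := (Fintype.equivFin κ).symm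
  refine ⟨Fintype.card κ, fun k => q (e k), fun k => φ (e k), fun k => ψ (e k),
    fun k => h0 _, ?_, fun k => h2 _, fun k => h3 _, fun v w => ?_⟩
  · rw [← h1]; exact Equiv.sum_comp e q
  · rw [h4 v w]
    exact (Equiv.sum_comp e (fun k => (q k : ℂ)
        * (φ k (v i) * starRingEnd ℂ (φ k (w i)))
        * (ψ k (fun a => v a.1) * starRingEnd ℂ (ψ k (fun a => w a.1))))).symm

lemma sum_weight_two (i : Fin 3) (F : ℕ → ℝ) :
    ∑ x : ({a : Fin 3 // a ≠ i} → Fin 2), F (∑ a, (x a : ℕ)) = F 0 + 2 * F 1 + F 2 := by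
  rw [Finset.sum_comp F (fun x : ({a : Fin 3 // a ≠ i} → Fin 2) => ∑ a, (x a : ℕ))]
  have h : (Finset.univ.image (fun x : ({a : Fin 3 // a ≠ i} → Fin 2) => ∑ a, (x a : ℕ)))
      = {0, 1, 2} := by revert i; decide
  have c0 : #{x : ({a : Fin 3 // a ≠ i} → Fin 2) | ∑ a, (x a : ℕ) = 0} = 1 := by
    revert i; decide
  have c1 : #{x : ({a : Fin 3 // a ≠ i} → Fin 2) | ∑ a, (x a : ℕ) = 1} = 2 := by
    revert i; decide
  have c2 : #{x : ({a : Fin 3 // a ≠ i} → Fin 2) | ∑ a, (x a : ℕ) = 2} = 1 := by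
    revert i; decide
  rw [h, Finset.sum_insert (by decide), Finset.sum_insert (by decide), Finset.sum_singleton,
    c0, c1, c2]
  simp only [nsmul_eq_mul]
  push_cast
  ring

lemma weight_split (i : Fin 3) (v : Fin 3 → Fin 2) :
    (v i : ℕ) + ∑ a : {a : Fin 3 // a ≠ i}, (v a.1 : ℕ) = ∑ j, (v j : ℕ) := by
  revert i v; decide

lemma weight_le (v : Fin 3 → Fin 2) : ∑ j, (v j : ℕ) ≤ 3 := by
  revert v; decide

lemma phase_sum (m n : ℕ) (hm : m ≤ 3) (hn : n ≤ 3) :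
    ∑ k : Fin 4, (Complex.I ^ ((k : ℕ) * m) * starRingEnd ℂ (Complex.I ^ ((k : ℕ) * n)))
      = if m = n then 4 else 0 := by
  interval_cases m <;> interval_cases n <;>
    simp [Fin.sum_univ_four, pow_succ, pow_mul] <;> norm_num

lemma restrict_eq_iff (i : Fin 3) (v w : Fin 3 → Fin 2) :
    (v i = w i ∧ (fun a : {a : Fin 3 // a ≠ i} => v a.1) = fun a => w a.1) ↔ v = w := by
  constructor
  · rintro ⟨h1, h2⟩
    funext j
    by_cases hj : j = i
    · rw [hj]; exact h1
    · exact congrFun h2 ⟨j, hj⟩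
  · rintro rfl; exact ⟨rfl, rfl⟩

lemma normSq_I_pow (n : ℕ) : Complex.normSq (Complex.I ^ n) = 1 := by simp

lemma sep_orbit (i : Fin 3) (z B G t : ℝ) (D : (Fin 3 → Fin 2) → ℝ) (ht : 0 ≤ t)
    (hD : ∀ x, 0 ≤ D x)
    (hsum : t * ((1 + z ^ 2) * (1 + 2 * B ^ 2 + G ^ 2)) + ∑ x, D x = 1) :
    SepPure i (fun v w => (((t * if (∑ j, (v j : ℕ)) = ∑ j, (w j : ℕ) then
      fAmp z B G i v * fAmp z B G i w else 0) + if v = w then D v else 0 : ℝ) : ℂ)) := by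
  have hA : 0 < 1 + z ^ 2 := by positivity
  have hB : 0 < 1 + 2 * B ^ 2 + G ^ 2 := by positivity
  obtain ⟨n1, hn1⟩ : ∃ n : ℝ, n ^ 2 * (1 + z ^ 2) = 1 :=
    ⟨(Real.sqrt (1 + z ^ 2))⁻¹, by rw [inv_pow, Real.sq_sqrt hA.le]; field_simp⟩
  obtain ⟨n2, hn2⟩ : ∃ n : ℝ, n ^ 2 * (1 + 2 * B ^ 2 + G ^ 2) = 1 :=
    ⟨(Real.sqrt (1 + 2 * B ^ 2 + G ^ 2))⁻¹, by rw [inv_pow, Real.sq_sqrt hB.le]; field_simp⟩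
  refine sepPure_of_fintype (κ := Fin 4 ⊕ (Fin 3 → Fin 2)) i _
    (Sum.elim (fun _ => t * ((1 + z ^ 2) * (1 + 2 * B ^ 2 + G ^ 2)) / 4) D)
    (Sum.elim (fun k x => Complex.I ^ ((k : ℕ) * (x : ℕ)) * ((n1 * z ^ (x : ℕ) : ℝ) : ℂ))
      (fun y x => if x = y i then 1 else 0))
    (Sum.elim (fun k x => Complex.I ^ ((k : ℕ) * ∑ a, (x a : ℕ)) *
        ((n2 * gAmp B G (∑ a, (x a : ℕ)) : ℝ) : ℂ))
      (fun y x => if x = (fun a => y a.1) then 1 else 0)) ?_ ?_ ?_ ?_ ?_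
  · rintro (k | y)
    · simp only [Sum.elim_inl]; positivity
    · exact hD y
  · rw [Fintype.sum_sum_type]
    simp only [Sum.elim_inl, Sum.elim_inr, Fin.sum_univ_four]
    linear_combination hsum
  · rintro (k | y)
    · simp only [Sum.elim_inl, Complex.normSq_mul, normSq_I_pow, Complex.normSq_ofReal,
        Fin.sum_univ_two]
      simp only [Fin.val_zero, Fin.val_one, pow_zero, pow_one]
      linear_combination hn1
    · simp only [Sum.elim_inr, apply_ite Complex.normSq]
      simp
  · rintro (k | y)
    · simp only [Sum.elim_inl, Complex.normSq_mul, normSq_I_pow, Complex.normSq_ofReal]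
      rw [sum_weight_two i (fun n => 1 * (n2 * gAmp B G n * (n2 * gAmp B G n)))]
      norm_num [gAmp]
      linear_combination hn2
    · simp only [Sum.elim_inr, apply_ite Complex.normSq]
      simp
  · intro v w
    rw [Fintype.sum_sum_type, Complex.ofReal_add]
    congr 1
    · simp only [Sum.elim_inl]
      have key : ∀ k : Fin 4,
          ((t * ((1 + z ^ 2) * (1 + 2 * B ^ 2 + G ^ 2)) / 4 : ℝ) : ℂ) *
          (Complex.I ^ ((k : ℕ) * (v i : ℕ)) * ((n1 * z ^ (v i : ℕ) : ℝ) : ℂ) *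
            starRingEnd ℂ (Complex.I ^ ((k : ℕ) * (w i : ℕ)) * ((n1 * z ^ (w i : ℕ) : ℝ) : ℂ))) *
          (Complex.I ^ ((k : ℕ) * ∑ a : {a : Fin 3 // a ≠ i}, (v a.1 : ℕ)) *
            ((n2 * gAmp B G (∑ a : {a : Fin 3 // a ≠ i}, (v a.1 : ℕ)) : ℝ) : ℂ) *
            starRingEnd ℂ (Complex.I ^ ((k : ℕ) * ∑ a : {a : Fin 3 // a ≠ i}, (w a.1 : ℕ)) *
            ((n2 * gAmp B G (∑ a : {a : Fin 3 // a ≠ i}, (w a.1 : ℕ)) : ℝ) : ℂ)))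
          = ((t / 4 * (fAmp z B G i v * fAmp z B G i w) : ℝ) : ℂ) *
            (Complex.I ^ ((k : ℕ) * ∑ j, (v j : ℕ)) *
              starRingEnd ℂ (Complex.I ^ ((k : ℕ) * ∑ j, (w j : ℕ)))) := by
        intro k
        rw [← weight_split i v, ← weight_split i w]
        have e : t / 4 * (fAmp z B G i v * fAmp z B G i w)
            = (t * ((1 + z ^ 2) * (1 + 2 * B ^ 2 + G ^ 2)) / 4) *
              ((n1 * z ^ (v i : ℕ)) * (n1 * z ^ (w i : ℕ))) *
              ((n2 * gAmp B G (∑ a : {a : Fin 3 // a ≠ i}, (v a.1 : ℕ))) *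
               (n2 * gAmp B G (∑ a : {a : Fin 3 // a ≠ i}, (w a.1 : ℕ)))) := by
          unfold fAmp
          generalize gAmp B G (∑ a : {a : Fin 3 // a ≠ i}, (v a.1 : ℕ)) = g1
          generalize gAmp B G (∑ a : {a : Fin 3 // a ≠ i}, (w a.1 : ℕ)) = g2
          generalize z ^ (v i : ℕ) = z1
          generalize z ^ (w i : ℕ) = z2
          calc t / 4 * (z1 * g1 * (z2 * g2))
              = t / 4 * (z1 * g1 * (z2 * g2)) * (n1 ^ 2 * (1 + z ^ 2)) *
                (n2 ^ 2 * (1 + 2 * B ^ 2 + G ^ 2)) := by rw [hn1, hn2]; ring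
            _ = _ := by ring
        rw [e]
        simp only [map_mul, Complex.conj_ofReal, mul_add, pow_add, Complex.ofReal_mul]
        ring
      rw [Finset.sum_congr rfl (fun k _ => key k), ← Finset.mul_sum,
        phase_sum _ _ (weight_le v) (weight_le w)]
      split_ifs
      · push_cast; ring
      · simp
    · simp only [Sum.elim_inr]
      have key : ∀ y : Fin 3 → Fin 2,
          ((D y : ℝ) : ℂ) * ((if v i = y i then (1 : ℂ) else 0) *
            starRingEnd ℂ (if w i = y i then (1 : ℂ) else 0)) *
          ((if (fun a : {a : Fin 3 // a ≠ i} => v a.1) = (fun a => y a.1) then (1 : ℂ) else 0) *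
            starRingEnd ℂ (if (fun a : {a : Fin 3 // a ≠ i} => w a.1) = (fun a => y a.1)
              then (1 : ℂ) else 0))
          = if v = y then (if w = y then ((D y : ℝ) : ℂ) else 0) else 0 := by
        intro y
        simp only [← restrict_eq_iff i v y, ← restrict_eq_iff i w y]
        by_cases h1 : v i = y i <;> by_cases h2 : w i = y i <;>
        by_cases h3 : (fun a : {a : Fin 3 // a ≠ i} => v a.1) = (fun a => y a.1) <;>
        by_cases h4 : (fun a : {a : Fin 3 // a ≠ i} => w a.1) = (fun a => y a.1) <;>
        simp only [h1, h2, h3, h4] <;> simp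
      rw [Finset.sum_congr rfl (fun k _ => key k)]
      simp only [Finset.sum_ite_eq, Finset.mem_univ, if_true]
      by_cases h : v = w
      · simp [h]
      · simp [h, Ne.symm h]

lemma sub_sums (v : Fin 3 → Fin 2) :
    (∑ a : {a : Fin 3 // a ≠ 0}, (v a.1 : ℕ)) = (v 1 : ℕ) + v 2 ∧
    (∑ a : {a : Fin 3 // a ≠ 1}, (v a.1 : ℕ)) = (v 0 : ℕ) + v 2 ∧
    (∑ a : {a : Fin 3 // a ≠ 2}, (v a.1 : ℕ)) = (v 0 : ℕ) + v 1 := by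
  revert v; decide

/-- The real symmetrized identity. -/
lemma total_identity (z B G t p T l : ℝ) (a : ℝ)
    (hzz : z ^ 2 = a) (hzB : z * B * (z * B) = 4 / 3) (hG : G * G = 1 / 3)
    (hzBG : z * B * G = - 2 / 3)
    (hdiag0 : t + l = p / 8)
    (hdiag1 : t * (a + 2 * B ^ 2) / 3 + l = (1 - p) / 3 + p / 8)
    (hoff : t * (2 * (z * B) + B ^ 2) / 3 = (1 - p) / 3)
    (hT : T = t * (1 - a / 3))
    (v w : Fin 3 → Fin 2) :
    (1 - p) * (if (∑ i, (v i : ℕ)) = 1 ∧ (∑ i, (w i : ℕ)) = 1 then 1 / 3 else 0)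
      + p / 8 * (if v = w then 1 else 0)
    = ∑ i, 1 / 3 * ((t * if (∑ j, (v j : ℕ)) = ∑ j, (w j : ℕ) then
      fAmp z B G i v * fAmp z B G i w else 0) +
      if v = w then (l + if v = 1 then T else 0) else 0) := by
  obtain ⟨s0, s1, s2⟩ := sub_sums v
  obtain ⟨r0, r1, r2⟩ := sub_sums w
  have hv : v = ![v 0, v 1, v 2] := by ext j; fin_cases j <;> rfl
  have hw : w = ![w 0, w 1, w 2] := by ext j; fin_cases j <;> rfl
  have h1 : (1 : Fin 3 → Fin 2) = ![1, 1, 1] := by ext j; fin_cases j <;> rfl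
  simp only [Fin.sum_univ_three, fAmp, s0, s1, s2, r0, r1, r2]
  rw [hv, hw, h1]
  generalize v 0 = x0
  generalize v 1 = x1
  generalize v 2 = x2
  generalize w 0 = y0
  generalize w 1 = y1
  generalize w 2 = y2
  have hB' : G ^ 2 = 1 / 3 := by rw [sq, hG]
  have hzB2 : z ^ 2 * B ^ 2 = 4 / 3 := by rw [← hzB]; ring
  subst hT
  fin_cases x0 <;> fin_cases x1 <;> fin_cases x2 <;> fin_cases y0 <;> fin_cases y1 <;>
    fin_cases y2 <;> simp [gAmp] <;>
    first
    | linear_combination -hdiag0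
    | linear_combination -hdiag1 - t / 3 * hzz
    | linear_combination -hoff
    | linear_combination -hdiag0 - t / 3 * hB' - 2 * t / 3 * hzB2
    | linear_combination -t / 3 * hzB - 2 * t / 3 * hzBG
    | linear_combination -hdiag0 - t * z ^ 2 * hB' - t / 3 * hzz

lemma pBar_params : ∃ b a : ℝ, 1 ≤ b ∧ 0 < a ∧ a ≤ 3 ∧ a * b = 4 / 3 ∧
    a + b = 3 + 4 * Real.sqrt 3 / 3 ∧ pBar * (b + 8 + 4 * Real.sqrt 3 / 3) = 8 ∧
    0 < pBar ∧ pBar < 1 := by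
  set s := Real.sqrt 3 with hs
  have hs2 : s ^ 2 = 3 := Real.sq_sqrt (by norm_num)
  have hs0 : 0 ≤ s := Real.sqrt_nonneg _
  have hsl : 1.732 < s := by nlinarith
  have hsu : s < 1.7321 := by nlinarith
  set r := Real.sqrt (2894 * s - 2988) with hr
  have hr2 : r ^ 2 = 2894 * s - 2988 := Real.sq_sqrt (by linarith)
  have hr0 : 0 ≤ r := Real.sqrt_nonneg _
  have hrl : 44.9 < r := by nlinarith
  have hru : r < 45.1 := by nlinarith
  have hp : pBar = (367 - 71 * s - r) / 382 := rfl
  have hpl : 0.51 < pBar := by rw [hp]; linarith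
  have hpu : pBar < 0.53 := by rw [hp]; linarith
  have hr' : r = 367 - 71 * s - 382 * pBar := by rw [hp]; ring
  have hq0 : (367 - 71 * s - 382 * pBar) ^ 2 = 2894 * s - 2988 := by rw [← hr', hr2]
  have hq : (25 + 9 * s) * pBar ^ 2 - (38 + 8 * s) * pBar + 16 = 0 := by
    have h : (25 - 9 * s) * ((25 + 9 * s) * pBar ^ 2 - (38 + 8 * s) * pBar + 16) = 0 := by
      linear_combination (1 / 382) * hq0 + (-81 * pBar ^ 2 + 72 * pBar - 5041 / 382) * hs2
    rcases mul_eq_zero.mp h with h | h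
    · linarith
    · exact h
  have hpp : pBar ≠ 0 := by linarith
  have hb : pBar * (8 / pBar) = 8 := by field_simp
  have hy1 : 15 < 8 / pBar := by rw [lt_div_iff₀ (by linarith)]; linarith
  have hy2 : 8 / pBar < 16 := by rw [div_lt_iff₀ (by linarith)]; linarith
  set y := 8 / pBar with hy
  have hquad : (y - 8 - 4 * s / 3) ^ 2 - (3 + 4 * s / 3) * (y - 8 - 4 * s / 3) + 4 / 3 = 0 := by
    have h : pBar ^ 2 * ((y - 8 - 4 * s / 3) ^ 2 - (3 + 4 * s / 3) * (y - 8 - 4 * s / 3) + 4 / 3)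
        = 0 := by
      have e : pBar ^ 2 * ((y - 8 - 4 * s / 3) ^ 2 - (3 + 4 * s / 3) * (y - 8 - 4 * s / 3) + 4 / 3)
        = (pBar * y - (8 + 4 * s / 3) * pBar) ^ 2
          - (3 + 4 * s / 3) * pBar * (pBar * y - (8 + 4 * s / 3) * pBar) + 4 / 3 * pBar ^ 2 := by
        ring
      rw [e, hb]
      linear_combination 4 * hq + (32 / 9 * pBar ^ 2) * hs2
    rcases mul_eq_zero.mp h with h | h
    · exact absurd h (by positivity)
    · exact h
  refine ⟨y - 8 - 4 * s / 3, 3 + 4 * s / 3 - (y - 8 - 4 * s / 3), ?_, ?_, ?_, ?_, ?_, ?_, ?_, ?_⟩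
  · linarith
  · have hb1 : 0 < y - 8 - 4 * s / 3 := by linarith
    by_contra hc
    push Not at hc
    nlinarith
  · linarith
  · linear_combination -hquad
  · ring
  · rw [← hb]; ring
  · linarith
  · linarith

/-- for every `p̄ ≤ p ≤ 1`, the noisy W state `ρ(p)` is biseparable. -/
theorem noisy_W_state_biseparable (p : ℝ) (hp : pBar ≤ p) (hp1 : p ≤ 1) :
    IsBiseparable3 (rhoW p) := by
  obtain ⟨b, a, hb1, ha0, ha3, hab, hsum, hpb, hp0, hpl⟩ := pBar_params
  set s := Real.sqrt 3 with hs
  have hs2 : s ^ 2 = 3 := Real.sq_sqrt (by norm_num)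
  have hs0 : 0 < s := Real.sqrt_pos.mpr (by norm_num)
  have hB2 : Real.sqrt b ^ 2 = b := Real.sq_sqrt (by linarith)
  have hB0 : 0 < Real.sqrt b := Real.sqrt_pos.mpr (by linarith)
  set B := Real.sqrt b with hB
  -- choose the mixing weight
  obtain ⟨m, hm0, hm1, hm⟩ : ∃ m : ℝ, 0 ≤ m ∧ m ≤ 1 ∧ m * (1 - pBar) = 1 - p := by
    refine ⟨(1 - p) / (1 - pBar), ?_, ?_, ?_⟩
    · apply div_nonneg <;> linarith
    · rw [div_le_one (by linarith)]; linarith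
    · exact div_mul_cancel₀ _ (by linarith)
  obtain ⟨z, hzB⟩ : ∃ z : ℝ, z * B = 2 * s / 3 := ⟨2 * s / 3 / B, by field_simp⟩
  have hzz : z ^ 2 = a := by
    have : z ^ 2 * b = a * b := by
      rw [hab, ← hB2, ← mul_pow, hzB]; linear_combination 4 / 9 * hs2
    exact mul_right_cancel₀ (by linarith) this
  have hG2 : (-s / 3) ^ 2 = 1 / 3 := by linear_combination hs2 / 9
  set G := -s / 3 with hG
  set t := m * pBar / 8 with ht
  set T := t * (1 - a / 3) with hT
  set l := (1 - m) / 8 with hl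
  have ht0 : 0 ≤ t := by positivity
  have hT0 : 0 ≤ T := mul_nonneg ht0 (by linarith)
  have hl0 : 0 ≤ l := by rw [hl]; linarith
  have hS : ∀ i, SepPure i (fun v w => (((t * if (∑ j, (v j : ℕ)) = ∑ j, (w j : ℕ) then
      fAmp z B G i v * fAmp z B G i w else 0) +
      if v = w then (l + if v = 1 then T else 0) else 0 : ℝ) : ℂ)) := by
    intro i
    refine sep_orbit i z B G t (fun v => l + if v = 1 then T else 0) ht0 ?_ ?_
    · intro x
      split_ifs <;> linarith
    · rw [Finset.sum_add_distrib]
      simp only [Finset.sum_ite_eq', Finset.mem_univ, if_true, Finset.sum_const, Finset.card_univ,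
        Fintype.card_fun, Fintype.card_fin, nsmul_eq_mul]
      rw [hzz, hB2, hG2, hT, hl, ht]
      push_cast
      linear_combination (m * pBar / 4) * hab + m / 8 * hpb + m * pBar / 8 * hsum
  refine ⟨1 / 3, 1 / 3, 1 / 3, _, _, _, by norm_num, by norm_num, by norm_num, by norm_num,
    hS 0, hS 1, hS 2, ?_⟩
  ext v w
  have key := total_identity z B G t p T l a hzz (by rw [hzB]; linear_combination 4 / 9 * hs2)
    (by rw [← sq, hG2]) (by rw [hzB, hG]; linear_combination -2 / 9 * hs2)
    (by rw [ht, hl]; linear_combination -hm / 8)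
    (by
      rw [hB2, ht, hl]
      linear_combination m * pBar / 24 * hsum + m / 24 * hpb + 5 / 24 * hm)
    (by
      rw [hB2, hzB, ht]
      linear_combination m / 24 * hpb + hm / 3)
    hT v w
  have hL : rhoW p v w = (((1 - p) * (if (∑ i, (v i : ℕ)) = 1 ∧ (∑ i, (w i : ℕ)) = 1 then 1 / 3
      else 0) + p / 8 * (if v = w then 1 else 0) : ℝ) : ℂ) := by
    have h3 : ((s : ℂ))⁻¹ * ((s : ℂ))⁻¹ = 1 / 3 := by
      rw [← mul_inv, ← sq]
      rw [show ((s : ℂ)) ^ 2 = 3 by exact_mod_cast hs2]; norm_num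
    simp only [rhoW, wVec, Matrix.add_apply, Matrix.smul_apply, Matrix.vecMulVec_apply,
      Pi.star_apply, Matrix.one_apply, smul_eq_mul, Complex.ofReal_add, Complex.ofReal_mul]
    congr 1
    · by_cases h1 : (∑ i, (v i : ℕ)) = 1 <;> by_cases h2 : (∑ i, (w i : ℕ)) = 1 <;>
        simp [h1, h2, ← hs, h3]
      try simp [h3]
    · split_ifs <;> simp
  rw [hL, key, Fin.sum_univ_three]
  rw [Complex.ofReal_add, Complex.ofReal_add, Complex.ofReal_mul, Complex.ofReal_mul,
    Complex.ofReal_mul]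
  rfl
end
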